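/- Let κ ∈ (0,4), ρ ≥ (κ-4)/2, a = 2ρ/κ, b = 1-4/κ, c = (2ρ+4)/κ, and U₀(x) = ₂F₁(a,b;c;x) on [0,1). Let f₀(x) = U₀'(x)/U₀(x). Then f₀(x) ≥ b/(1-x) for all x ∈ [0,1), f₀ is bounded on [0,1), and lim_{x→1⁻} f₀(x) = -a/2. -/

import Mathlib

noncomputable section

/-- The rising factorial (Pochhammer symbol) `(x)ₙ = x(x+1)⋯(x+n-1)`. -/
def ascPoch (x : ℝ) (n : ℕ) : ℝ := ∏ i ∈ Finset.range n, (x + i)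

/-- The Gauss hypergeometric function `₂F₁(a,b;c;x)`, defined by its power series. -/
def hyp2F1 (a b c x : ℝ) : ℝ :=
  ∑' n : ℕ, ascPoch a n * ascPoch b n / (ascPoch c n * (n.factorial : ℝ)) * x ^ n

/-- Coefficient of the hypergeometric series. -/
def hcf (a b c : ℝ) (n : ℕ) : ℝ := ascPoch a n * ascPoch b n / (ascPoch c n * (n.factorial : ℝ))

lemma ascPoch_succ' (x : ℝ) (n : ℕ) : ascPoch x (n+1) = ascPoch x n * (x + n) := by
  simp [ascPoch, Finset.prod_range_succ]

lemma ascPoch_shift (x : ℝ) (n : ℕ) : x * ascPoch (x+1) n = ascPoch x n * (x + n) := by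
  rw [← ascPoch_succ', ascPoch, ascPoch, Finset.prod_range_succ', mul_comm]
  congr 1
  · apply Finset.prod_congr rfl
    intro i _
    push_cast
    ring
  · simp

lemma ascPoch_pos (x : ℝ) (hx : 0 < x) (n : ℕ) : 0 < ascPoch x n :=
  Finset.prod_pos fun i _ => by positivity

lemma ascPoch_nonneg (x : ℝ) (hx : 0 ≤ x) (n : ℕ) : 0 ≤ ascPoch x n :=
  Finset.prod_nonneg fun i _ => by positivity

lemma hcf_zero (a b c : ℝ) : hcf a b c 0 = 1 := by simp [hcf, ascPoch]

lemma hcf_symm (a b c : ℝ) : hcf a b c = hcf b a c := by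
  funext n
  simp [hcf, mul_comm (ascPoch a n)]

lemma hyp_eq (a b c x : ℝ) : hyp2F1 a b c x = ∑' n, hcf a b c n * x ^ n := rfl

lemma hyp_symm (a b c x : ℝ) : hyp2F1 a b c x = hyp2F1 b a c x := by
  rw [hyp_eq, hyp_eq, hcf_symm]

lemma hcf_succ (a b c : ℝ) (hc : 0 < c) (n : ℕ) :
    ((n:ℝ)+1) * (c+n) * hcf a b c (n+1) = (a+n)*(b+n) * hcf a b c n := by
  have h1 := (ascPoch_pos c hc n).ne'
  have h2 : (n.factorial : ℝ) ≠ 0 := by positivity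
  have h3 : c + n ≠ 0 := by positivity
  have h4 : (n:ℝ) + 1 ≠ 0 := by positivity
  simp only [hcf, ascPoch_succ', Nat.factorial_succ]
  push_cast
  field_simp

lemma hcf_contig (a b c : ℝ) (hc : 0 < c) (n : ℕ) :
    ((n:ℝ)+1) * hcf a b c (n+1) - n * hcf a b c n - b * hcf a b c n
      = -b * ((c - a) / c) * hcf a (b+1) (c+1) n := by
  have h3 : c + n ≠ 0 := by positivity
  have hs := hcf_succ a b c hc n
  have h0 : ((n:ℝ)+1) * hcf a b c (n+1) = (a+n)*(b+n) * hcf a b c n / (c+n) := by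
    rw [eq_div_iff h3]; linarith
  have hv : b * hcf a (b+1) (c+1) n * (c+n) = hcf a b c n * (b+n) * c := by
    have h1 := (ascPoch_pos c hc n).ne'
    have h1' := (ascPoch_pos (c+1) (by linarith) n).ne'
    have h2 : (n.factorial : ℝ) ≠ 0 := by positivity
    have hb := ascPoch_shift b n
    have hcc := ascPoch_shift c n
    simp only [hcf]
    field_simp
    linear_combination ascPoch a n * ((ascPoch c n * (c + n)) * hb - ascPoch b n * (b+n) * hcc)
  rw [h0]
  field_simp
  linear_combination (-(c-a)) * hv * (-1)

lemma hcf_summable (a b c : ℝ) (hc : 0 < c) (hs : 1 < c - a - b) :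
    Summable (fun n : ℕ => (n:ℝ) * |hcf a b c n|) := by
  obtain ⟨N, hN⟩ := exists_nat_ge (1 + |a| + |b| + 2 * |a*b| / (c-a-b-1))
  have hd : 0 < c - a - b - 1 := by linarith
  have hq : 0 ≤ 2 * |a*b| / (c-a-b-1) := by positivity
  have key : ∀ n : ℕ, N ≤ n → (c-a-b-1)/2 * (n * |hcf a b c n|) ≤
      n * (n + c - 1) * |hcf a b c n| - ((n+1:ℕ):ℝ) * (((n+1:ℕ):ℝ) + c - 1) * |hcf a b c (n+1)| := by
    intro n hn
    have hn' : (N:ℝ) ≤ n := by exact_mod_cast hn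
    have ha1 := neg_abs_le a
    have hb1 := neg_abs_le b
    have ha2 := abs_nonneg a
    have hb2 := abs_nonneg b
    have hA : 0 < a + n := by linarith
    have hB : 0 < b + n := by linarith
    have hab : 2 * |a*b| ≤ n * (c-a-b-1) := by
      rw [← div_le_iff₀ hd]; linarith
    have hab' := le_abs_self (a*b)
    have e := congrArg abs (hcf_succ a b c hc n)
    rw [abs_mul (((n:ℝ)+1)*(c+n)), abs_mul ((a+n)*(b+n)),
      abs_of_pos (show 0 < ((n:ℝ)+1)*(c+n) by positivity),
      abs_of_pos (mul_pos hA hB)] at e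
    push_cast
    have : 0 ≤ |hcf a b c n| * (n * (c-a-b-1)/2 - a*b) :=
      mul_nonneg (abs_nonneg _) (by linarith)
    linear_combination this + e
  rw [← summable_nat_add_iff N]
  apply summable_of_sum_range_le (c := (N * (N + c - 1) * |hcf a b c N|) / ((c-a-b-1)/2))
  · intro n; positivity
  · intro m
    rw [le_div_iff₀ (by linarith)]
    have h : ∀ m : ℕ, (∑ i ∈ Finset.range m, (((i+N:ℕ):ℝ) * |hcf a b c (i+N)|)) * ((c-a-b-1)/2)
        ≤ N * (N + c - 1) * |hcf a b c N|
          - ((m+N:ℕ):ℝ) * (((m+N:ℕ):ℝ) + c - 1) * |hcf a b c (m+N)| := by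
      intro m
      induction m with
      | zero => simp
      | succ k ih =>
        rw [Finset.sum_range_succ, add_mul]
        have := key (k+N) (by omega)
        rw [show k + 1 + N = k + N + 1 by ring]
        linarith
    have hh := h m
    have : 0 ≤ ((m+N:ℕ):ℝ) * (((m+N:ℕ):ℝ) + c - 1) * |hcf a b c (m+N)| := by
      have : (1:ℝ) ≤ ((m+N:ℕ):ℝ) := by
        push_cast
        have := abs_nonneg a
        have := abs_nonneg b
        have : (0:ℝ) ≤ m := by positivity
        linarith
      have : 0 ≤ ((m+N:ℕ):ℝ) + c - 1 := by linarith
      positivity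
    linarith

lemma hcf_summable0 (a b c : ℝ) (hc : 0 < c) (hs : 1 < c - a - b) :
    Summable (fun n : ℕ => |hcf a b c n|) := by
  rw [← summable_nat_add_iff 1]
  refine Summable.of_nonneg_of_le (fun _ => abs_nonneg _) ?_
    ((summable_nat_add_iff 1).2 (hcf_summable a b c hc hs))
  intro n
  push_cast
  have : (0:ℝ) ≤ n := by positivity
  nlinarith [abs_nonneg (hcf a b c (n+1))]

lemma hcf_summable1 (a b c : ℝ) (hc : 0 < c) (hs : 1 < c - a - b) :
    Summable (fun n : ℕ => |((n:ℝ)+1) * hcf a b c (n+1)|) := by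
  refine ((summable_nat_add_iff 1).2 (hcf_summable a b c hc hs)).congr ?_
  intro n
  push_cast
  rw [abs_mul, abs_of_pos (by positivity : (0:ℝ) < n + 1)]

lemma bnd_pow (u x : ℝ) (hx : |x| ≤ 1) (n : ℕ) : ‖u * x ^ n‖ ≤ |u| := by
  rw [Real.norm_eq_abs, abs_mul, abs_pow]
  exact mul_le_of_le_one_right (abs_nonneg _) (pow_le_one₀ (abs_nonneg _) hx)

lemma summ_pow (u : ℕ → ℝ) (hu : Summable fun n => |u n|) (x : ℝ) (hx : |x| ≤ 1) :
    Summable fun n => u n * x ^ n :=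
  Summable.of_norm_bounded hu fun n => bnd_pow _ _ hx n

lemma cont_pow (u : ℕ → ℝ) (hu : Summable fun n => |u n|) :
    ContinuousOn (fun x : ℝ => ∑' n, u n * x ^ n) (Set.Icc 0 1) :=
  continuousOn_tsum (fun n => by fun_prop) hu fun n x hx =>
    bnd_pow _ _ (abs_le.2 ⟨by linarith [hx.1], hx.2⟩) n

/-- Series of the derivative. -/
def dhyp (a b c x : ℝ) : ℝ := ∑' n : ℕ, (((n:ℝ)+1) * hcf a b c (n+1)) * x ^ n

lemma hyp_hasDerivAt (a b c : ℝ) (hc : 0 < c) (hs : 1 < c - a - b) (x : ℝ) (hx : |x| < 1) :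
    HasDerivAt (hyp2F1 a b c) (dhyp a b c x) x := by
  have h := hasDerivAt_tsum_of_isPreconnected (𝕜 := ℝ) (F := ℝ) (t := Metric.ball (0:ℝ) 1)
    (g := fun (n:ℕ) (y:ℝ) => hcf a b c n * y ^ n)
    (g' := fun (n:ℕ) (y:ℝ) => hcf a b c n * (n * y ^ (n-1))) (y₀ := 0) (y := x)
    (hcf_summable a b c hc hs) Metric.isOpen_ball (convex_ball (0:ℝ) 1).isPreconnected
    (fun n y _ => (hasDerivAt_pow n y).const_mul _)
    (fun n y hy => by
      have hy' : |y| ≤ 1 := by simpa using (Metric.mem_ball.1 hy).le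
      have := bnd_pow (n * hcf a b c n) y hy' (n-1)
      rw [abs_mul, abs_of_nonneg (by positivity : (0:ℝ) ≤ n)] at this
      rwa [show hcf a b c n * (n * y ^ (n-1)) = n * hcf a b c n * y ^ (n-1) by ring])
    (by simp) (summ_pow _ (hcf_summable0 a b c hc hs) 0 (by simp)) (by simpa using hx)
  have e : (∑' n : ℕ, hcf a b c n * (n * x ^ (n-1))) = dhyp a b c x := by
    have hsm : Summable fun n : ℕ => hcf a b c n * (n * x ^ (n-1)) := by
      rw [← summable_nat_add_iff 1]
      refine (summ_pow _ (hcf_summable1 a b c hc hs) x hx.le).congr ?_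
      intro n
      rw [Nat.add_sub_cancel]
      push_cast
      ring
    rw [hsm.tsum_eq_zero_add, dhyp]
    simp only [Nat.cast_zero, zero_mul, mul_zero, zero_add]
    apply tsum_congr
    intro n
    rw [Nat.add_sub_cancel]
    push_cast
    ring
  rw [← e]
  exact h

lemma hyp_contig (a b c : ℝ) (hc : 0 < c) (hs : 1 < c - a - b) (x : ℝ) (hx : |x| ≤ 1) :
    (1 - x) * dhyp a b c x - b * hyp2F1 a b c x
      = -b * ((c - a) / c) * hyp2F1 a (b+1) (c+1) x := by
  have s0 := summ_pow _ (hcf_summable0 a b c hc hs) x hx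
  have s1 := summ_pow _ (hcf_summable1 a b c hc hs) x hx
  have hn : Summable fun n : ℕ => (n * hcf a b c n) * x ^ n := by
    apply summ_pow _ _ x hx
    refine (hcf_summable a b c hc hs).congr fun n => ?_
    rw [abs_mul, abs_of_nonneg (by positivity : (0:ℝ) ≤ n)]
  have e : x * dhyp a b c x = ∑' n : ℕ, (n * hcf a b c n) * x ^ n := by
    rw [hn.tsum_eq_zero_add, dhyp, ← tsum_mul_left]
    simp only [Nat.cast_zero, zero_mul, zero_add]
    apply tsum_congr
    intro n
    push_cast
    ring
  rw [sub_mul, one_mul, e, dhyp, hyp_eq, hyp_eq, ← tsum_mul_left, ← tsum_mul_left,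
    ← s1.tsum_sub hn, ← (s1.sub hn).tsum_sub (s0.mul_left b)]
  apply tsum_congr
  intro n
  rw [← mul_assoc _ (hcf a (b+1) (c+1) n), ← hcf_contig a b c hc n]
  ring

lemma hyp_zero (a b c : ℝ) : hyp2F1 a b c 0 = 1 := by
  rw [hyp_eq, tsum_eq_single 0]
  · simp [hcf_zero]
  · intro n hn; simp [hn]

/-- One contiguity step for positivity. -/
lemma pos_step (a b c : ℝ) (hc : 0 < c) (hs : 1 < c - a - b) (hac : a < c) (hb : b < 0)
    (h : ∀ x ∈ Set.Icc (0:ℝ) 1, 0 < hyp2F1 a (b+1) (c+1) x) :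
    ∀ x ∈ Set.Icc (0:ℝ) 1, 0 < hyp2F1 a b c x := by
  have hk : 0 < -b * ((c - a) / c) := mul_pos (by linarith) (div_pos (by linarith) hc)
  intro x hx
  rcases hx.2.lt_or_eq with h1 | h1
  · have hder : ∀ y ∈ Set.Ico (0:ℝ) 1, HasDerivAt (fun y => (1 - y) ^ b * hyp2F1 a b c y)
        ((1-y)^(b-1) * (-b * ((c - a) / c) * hyp2F1 a (b+1) (c+1) y)) y := by
      intro y hy
      have hy1 : 0 < 1 - y := by linarith [hy.2]
      have hya : |y| < 1 := abs_lt.2 ⟨by linarith [hy.1], hy.2⟩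
      have d1 : HasDerivAt (fun y : ℝ => (1 - y) ^ b) ((-1) * b * (1-y)^(b-1)) y :=
        ((hasDerivAt_id y).const_sub 1).rpow_const (Or.inl hy1.ne')
      have d2 := d1.mul (hyp_hasDerivAt a b c hc hs y hya)
      refine d2.congr_deriv ?_
      rw [← hyp_contig a b c hc hs y hya.le]
      have : (1-y)^b = (1-y)^(b-1) * (1-y) := by
        rw [← Real.rpow_add_one hy1.ne']; simp
      rw [this]
      ring
    have hm : MonotoneOn (fun y => (1 - y) ^ b * hyp2F1 a b c y) (Set.Ico 0 1) := by
      apply monotoneOn_of_deriv_nonneg (convex_Ico 0 1)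
      · exact fun y hy => (hder y hy).continuousAt.continuousWithinAt
      · intro y hy
        exact (hder y (interior_subset hy)).differentiableAt.differentiableWithinAt
      · intro y hy
        have hy := interior_subset hy
        rw [(hder y hy).deriv]
        have := h y ⟨hy.1, hy.2.le⟩
        have : 0 ≤ (1-y)^(b-1) := Real.rpow_nonneg (by linarith [hy.2]) _
        positivity
    have := hm ⟨le_rfl, one_pos⟩ ⟨hx.1, h1⟩ hx.1
    simp only [sub_zero, Real.one_rpow, hyp_zero, one_mul] at this
    have hp : 0 < (1-x)^b := Real.rpow_pos_of_pos (by linarith) _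
    exact pos_of_mul_pos_right (a := (1-x)^b) (by linarith) hp.le
  · have e := hyp_contig a b c hc hs x (by simp [h1])
    have := mul_pos hk (h x hx)
    rw [← e, h1] at this
    rw [h1]
    have h2 : 0 < (-b) * hyp2F1 a b c 1 := by linarith
    exact pos_of_mul_pos_right h2 (by linarith)

lemma pos_base (a b c : ℝ) (hc : 0 < c) (hs : 1 < c - a - b) (ha : 0 ≤ a) (hb : 0 ≤ b) :
    ∀ x ∈ Set.Icc (0:ℝ) 1, 0 < hyp2F1 a b c x := by
  intro x hx
  have s0 := summ_pow _ (hcf_summable0 a b c hc hs) x (abs_le.2 ⟨by linarith [hx.1], hx.2⟩)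
  rw [hyp_eq]
  refine s0.tsum_pos (fun n => ?_) 0 (by simp [hcf_zero])
  have := ascPoch_nonneg a ha n
  have := ascPoch_nonneg b hb n
  have := ascPoch_pos c hc n
  have := hx.1
  unfold hcf
  positivity

lemma pos_half (n : ℕ) : ∀ a b c : ℝ, 0 < c → 1 < c - a - b → a < c → 0 ≤ a → -(n:ℝ) ≤ b →
    ∀ x ∈ Set.Icc (0:ℝ) 1, 0 < hyp2F1 a b c x := by
  induction n with
  | zero =>
    intro a b c hc hs _ ha hb
    exact pos_base a b c hc hs ha (by simpa using hb)
  | succ k ih =>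
    intro a b c hc hs hac ha hb
    by_cases hb0 : 0 ≤ b
    · exact pos_base a b c hc hs ha hb0
    · push_cast at hb
      exact pos_step a b c hc hs hac (by linarith)
        (ih a (b+1) (c+1) (by linarith) (by linarith) (by linarith) ha (by linarith))

lemma pos_full (n : ℕ) : ∀ a b c : ℝ, 0 < c → 1 < c - a - b → a < c → b < c → -(n:ℝ) ≤ b →
    ∀ x ∈ Set.Icc (0:ℝ) 1, 0 < hyp2F1 a b c x := by
  have hnn : ∀ a b c : ℝ, 0 < c → 1 < c - a - b → a < c → b < c → 0 ≤ b →
      ∀ x ∈ Set.Icc (0:ℝ) 1, 0 < hyp2F1 a b c x := by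
    intro a b c hc hs hac hbc hb x hx
    obtain ⟨m, hm⟩ := exists_nat_ge (-a)
    rw [hyp_symm]
    exact pos_half m b a c hc (by linarith) hbc hb (by linarith) x hx
  induction n with
  | zero =>
    intro a b c hc hs hac hbc hb
    exact hnn a b c hc hs hac hbc (by simpa using hb)
  | succ k ih =>
    intro a b c hc hs hac hbc hb
    by_cases hb0 : 0 ≤ b
    · exact hnn a b c hc hs hac hbc hb0
    · push_cast at hb
      exact pos_step a b c hc hs hac (by linarith)
        (ih a (b+1) (c+1) (by linarith) (by linarith) (by linarith) (by linarith) (by linarith))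

lemma hyp_pos (a b c : ℝ) (hc : 0 < c) (hs : 1 < c - a - b) (hac : a < c) (hbc : b < c) :
    ∀ x ∈ Set.Icc (0:ℝ) 1, 0 < hyp2F1 a b c x := by
  obtain ⟨m, hm⟩ := exists_nat_ge (-b)
  exact pos_full m a b c hc hs hac hbc (by linarith)

lemma lim_zero (f : ℕ → ℝ) (hf : Summable f) (L : ℝ)
    (h : Filter.Tendsto (fun n : ℕ => (n:ℝ) * f n) Filter.atTop (nhds L)) : L = 0 := by
  by_contra hL
  apply Real.not_summable_one_div_natCast
  refine summable_of_isBigO_nat hf.abs ?_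
  have hp : 0 < |L| := abs_pos.2 hL
  have h2 := (h.abs).eventually (lt_mem_nhds (half_lt_self hp))
  apply Asymptotics.IsBigO.of_bound (2/|L|)
  filter_upwards [h2, Filter.eventually_gt_atTop 0] with n hn hn0
  have hn0' : (0:ℝ) < n := by exact_mod_cast hn0
  rw [abs_mul, abs_of_pos hn0'] at hn
  rw [Real.norm_eq_abs, Real.norm_eq_abs, abs_abs, abs_of_pos (by positivity), div_mul_eq_mul_div,
    div_le_div_iff₀ hn0' hp]
  linarith

lemma gauss_rel (a b c : ℝ) (hc : 0 < c) (hs : 1 < c - a - b) :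
    (c - a - b - 1) * dhyp a b c 1 = a * b * hyp2F1 a b c 1 := by
  have s0 : Summable (hcf a b c) := (hcf_summable0 a b c hc hs).of_abs
  have hn : Summable fun n : ℕ => (n:ℝ) * hcf a b c n := by
    apply Summable.of_abs
    refine (hcf_summable a b c hc hs).congr fun n => ?_
    rw [abs_mul, abs_of_nonneg (by positivity : (0:ℝ) ≤ n)]
  have hd : dhyp a b c 1 = ∑' n : ℕ, (n:ℝ) * hcf a b c n := by
    rw [hn.tsum_eq_zero_add, dhyp]
    simp
  have hu : hyp2F1 a b c 1 = ∑' n : ℕ, hcf a b c n := by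
    rw [hyp_eq]; simp
  have hsum := ((s0.mul_left (a*b)).sub (hn.mul_left (c-a-b-1)))
  have ht := hsum.hasSum.tendsto_sum_nat
  rw [(s0.mul_left (a*b)).tsum_sub (hn.mul_left (c-a-b-1)), tsum_mul_left, tsum_mul_left,
    ← hd, ← hu] at ht
  have hw : ∀ m : ℕ, ∑ n ∈ Finset.range m,
      (a*b*hcf a b c n - (c-a-b-1) * ((n:ℝ) * hcf a b c n)) = m * (m + c - 1) * hcf a b c m := by
    intro m
    induction m with
    | zero => simp
    | succ k ih =>
      rw [Finset.sum_range_succ, ih]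
      have := hcf_succ a b c hc k
      push_cast
      linear_combination -this
  simp only [hw] at ht
  have ht2 : Filter.Tendsto (fun m : ℕ => (m:ℝ) * (m * hcf a b c m)) Filter.atTop
      (nhds (a * b * hyp2F1 a b c 1 - (c-a-b-1) * dhyp a b c 1 - (c-1) * 0)) := by
    refine (ht.sub (hn.tendsto_atTop_zero.const_mul (c-1))).congr fun m => ?_
    ring
  have := lim_zero _ hn _ ht2
  linarith

/-- With `κ ∈ (0,4)`, `ρ ≥ (κ-4)/2`, `a = 2ρ/κ`, `b = 1-4/κ`, `c = (2ρ+4)/κ`,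
`U₀ = ₂F₁(a,b;c;·)` and `f₀ = U₀'/U₀` on `[0,1)`: `f₀(x) ≥ b/(1-x)` on `[0,1)`, `f₀` is
bounded on `[0,1)`, and `f₀(x) → -a/2` as `x → 1⁻`. -/
theorem stmt6 (κ ρ : ℝ) (hκ0 : 0 < κ) (hκ4 : κ < 4) (hρ : (κ - 4) / 2 ≤ ρ)
    (a b c : ℝ) (ha : a = 2 * ρ / κ) (hb : b = 1 - 4 / κ) (hc : c = (2 * ρ + 4) / κ)
    (U₀ f₀ : ℝ → ℝ) (hU₀ : ∀ x, U₀ x = hyp2F1 a b c x)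
    (hf₀ : ∀ x ∈ Set.Ico (0:ℝ) 1, f₀ x = deriv U₀ x / U₀ x) :
    (∀ x ∈ Set.Ico (0:ℝ) 1, b / (1 - x) ≤ f₀ x) ∧
    (∃ M : ℝ, ∀ x ∈ Set.Ico (0:ℝ) 1, |f₀ x| ≤ M) ∧
    Filter.Tendsto f₀ (nhdsWithin 1 (Set.Iio 1)) (nhds (-a / 2)) := by
  have ht : 1 < 4 / κ := by rw [lt_div_iff₀ hκ0]; linarith
  have hb0 : b < 0 := by linarith
  have hca : c = a + 1 - b := by
    rw [hc, ha, hb]; field_simp; ring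
  have hab : b ≤ a := by
    rw [ha, hb, show (1:ℝ) - 4/κ = (κ - 4)/κ by field_simp]
    exact div_le_div_of_nonneg_right (by linarith) hκ0.le
  have hc0 : 0 < c := by linarith
  have hs : 1 < c - a - b := by linarith
  have hU : U₀ = hyp2F1 a b c := funext hU₀
  have hpos := hyp_pos a b c hc0 hs (by linarith) (by linarith)
  have hpos' := hyp_pos a (b+1) (c+1) (by linarith) (by linarith) (by linarith) (by linarith)
  have hf : ∀ x ∈ Set.Ico (0:ℝ) 1, f₀ x = dhyp a b c x / hyp2F1 a b c x := by
    intro x hx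
    rw [hf₀ x hx, hU, (hyp_hasDerivAt a b c hc0 hs x
      (abs_lt.2 ⟨by linarith [hx.1], hx.2⟩)).deriv]
  have hcont : ContinuousOn (fun x => dhyp a b c x / hyp2F1 a b c x) (Set.Icc 0 1) :=
    (cont_pow _ (hcf_summable1 a b c hc0 hs)).div (cont_pow _ (hcf_summable0 a b c hc0 hs))
      (fun x hx => (hpos x hx).ne')
  refine ⟨?_, ?_, ?_⟩
  · intro x hx
    have hx' : x ∈ Set.Icc (0:ℝ) 1 := ⟨hx.1, hx.2.le⟩
    rw [hf x hx, div_le_div_iff₀ (by linarith [hx.2]) (hpos x hx')]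
    have e := hyp_contig a b c hc0 hs x (abs_le.2 ⟨by linarith [hx.1], hx'.2⟩)
    have : 0 < -b * ((c - a) / c) * hyp2F1 a (b+1) (c+1) x :=
      mul_pos (mul_pos (by linarith) (div_pos (by linarith) hc0)) (hpos' x hx')
    linarith
  · obtain ⟨M, hM⟩ := isCompact_Icc.exists_bound_of_continuousOn hcont
    refine ⟨M, fun x hx => ?_⟩
    rw [hf x hx]
    exact hM x ⟨hx.1, hx.2.le⟩
  · have h1 := hcont 1 ⟨zero_le_one, le_rfl⟩
    have hv : dhyp a b c 1 / hyp2F1 a b c 1 = -a / 2 := by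
      have hp := hpos 1 ⟨zero_le_one, le_rfl⟩
      have g := gauss_rel a b c hc0 hs
      rw [div_eq_div_iff hp.ne' two_ne_zero]
      apply mul_left_cancel₀ hb0.ne
      rw [hca] at g ⊢
      linear_combination -g
    have h2 : Filter.Tendsto (fun x => dhyp a b c x / hyp2F1 a b c x)
        (nhdsWithin 1 (Set.Ico 0 1)) (nhds (-a/2)) := by
      rw [← hv]
      exact h1.mono_left (nhdsWithin_mono _ Set.Ico_subset_Icc_self)
    rw [nhdsWithin_Ico_eq_nhdsLT zero_lt_one] at h2
    refine h2.congr' ?_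
    filter_upwards [Ico_mem_nhdsLT (zero_lt_one (α := ℝ))] with x hx
    exact (hf x hx).symm
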